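/- Fix t ≥ 1. Let h_t(n) be the number of t-Pop-sortable bracket vectors in Vec_n and g_t(n) the number of t-Pop-sortable irreducible bracket vectors in Vec_n. Then the following formal power series identity holds: (1 + Σ_{n≥1} h_t(n) z^n)·(1 - Σ_{n≥1} g_t(n) z^n) = 1. -/

import Mathlib

open scoped Classical

/-- `b` is a bracket vector of size `n`: a tuple `(b_0, …, b_{2n-1})` with
`b_{2k+1} = k`, `⌊i/2⌋ ≤ b_i ≤ n-1`, and such that `b_i = k` forces `b_j ≤ k`
for all `i+1 ≤ j ≤ 2k+1`. -/
def IsBracketVec (n : ℕ) (b : List ℕ) : Prop :=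
  b.length = 2 * n ∧
    (∀ k : ℕ, k < n → b.getD (2 * k + 1) 0 = k) ∧
    (∀ i : ℕ, i < 2 * n → i / 2 ≤ b.getD i 0 ∧ b.getD i 0 ≤ n - 1) ∧
    (∀ i : ℕ, i < 2 * n → ∀ j : ℕ, i + 1 ≤ j → j ≤ 2 * b.getD i 0 + 1 →
      b.getD j 0 ≤ b.getD i 0)

/-- The minimum bracket vector `m_n`, with `(m_n)_i = ⌊i/2⌋`. -/
def minVec (n : ℕ) : List ℕ := (List.range (2 * n)).map (fun i => i / 2)

/-- The entries of the image of a bracket vector of size `n` under `Pop`: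
`η_i(b) = b_i` if `i = 2n-1` or `b_i ≤ b_{i+1}`, and otherwise `η_i(b)` is the
largest `x` with `⌊i/2⌋ ≤ x ≤ b_i - 1` and `b_j ≤ x` for all `i+1 ≤ j ≤ 2x+1`. -/
noncomputable def eta (n : ℕ) (b : List ℕ) (i : ℕ) : ℕ :=
  if i = 2 * n - 1 ∨ b.getD i 0 ≤ b.getD (i + 1) 0 then b.getD i 0
  else ((Finset.range (b.getD i 0)).filter
      (fun x => i / 2 ≤ x ∧ ∀ j ∈ Finset.Icc (i + 1) (2 * x + 1), b.getD j 0 ≤ x)).sup id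

/-- The `Pop` operator on bracket vectors of size `n`. -/
noncomputable def popVec (n : ℕ) (b : List ℕ) : List ℕ := (List.range (2 * n)).map (eta n b)

/-- A bracket vector of size `n` is `t`-Pop-sortable if `t` applications of `Pop`
yield the minimum vector `m_n`. -/
def PopSortable (n t : ℕ) (b : List ℕ) : Prop := (popVec n)^[t] b = minVec n

/-- A bracket vector of size `n` is irreducible if `b_0 = b_{2n-1}`. -/
def IsIrredVec (n : ℕ) (b : List ℕ) : Prop :=
  IsBracketVec n b ∧ b.getD 0 0 = b.getD (2 * n - 1) 0

/-- The sum of a list of bracket vectors: the vector of `b ∈ Vec_{n₁}` and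
`b' ∈ Vec_{n₂}` is `(b_0, …, b_{2n₁-1}, b'_0 + n₁, …, b'_{2n₂-1} + n₁) ∈ Vec_{n₁+n₂}`. -/
def sumVecs : List (List ℕ) → List ℕ
  | [] => []
  | v :: L => v ++ (sumVecs L).map (· + v.length / 2)

/-- `L` is a decomposition of `b` into (nonempty) irreducible bracket vectors. -/
def IsIrredDecomp (b : List ℕ) (L : List (List ℕ)) : Prop :=
  (∀ v ∈ L, 1 ≤ v.length / 2 ∧ IsIrredVec (v.length / 2) v) ∧ b = sumVecs L

/-- The hash of a bracket vector: delete the first two entries and subtract `1`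
from all remaining entries. -/
def hashVec (b : List ℕ) : List ℕ := (b.drop 2).map (· - 1)

namespace IsBracketVec

variable {n : ℕ} {b : List ℕ}

theorem odd_entry (hb : IsBracketVec n b) {i : ℕ} (hi : i < 2 * n) (ho : i % 2 = 1) :
    b.getD i 0 = i / 2 := by
  have h := hb.2.1 (i / 2) (by omega)
  rwa [show 2 * (i / 2) + 1 = i by omega] at h

/-- The set of candidates in the definition of `eta` contains `⌊i/2⌋`. -/
theorem half_mem_candidates (hb : IsBracketVec n b) {i : ℕ} (hi : i < 2 * n)
    (h : ¬(i = 2 * n - 1 ∨ b.getD i 0 ≤ b.getD (i + 1) 0)) :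
    i / 2 ∈ (Finset.range (b.getD i 0)).filter
      (fun x => i / 2 ≤ x ∧ ∀ j ∈ Finset.Icc (i + 1) (2 * x + 1), b.getD j 0 ≤ x) := by
  rw [not_or] at h
  have h1 := (hb.2.2.1 i hi).1
  have h2 := (hb.2.2.1 (i + 1) (by omega)).1
  simp only [Finset.mem_filter, Finset.mem_range]
  refine ⟨by omega, le_rfl, fun j hj => ?_⟩
  rw [Finset.mem_Icc] at hj
  rw [hb.odd_entry (i := j) (by omega) (by omega)]
  omega

theorem eta_cases (hb : IsBracketVec n b) {i : ℕ} (hi : i < 2 * n) :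
    (eta n b i = b.getD i 0) ∨ (b.getD (i + 1) 0 < b.getD i 0 ∧ eta n b i < b.getD i 0 ∧
      i / 2 ≤ eta n b i ∧
      ∀ j, i + 1 ≤ j → j ≤ 2 * eta n b i + 1 → b.getD j 0 ≤ eta n b i) := by
  by_cases h : i = 2 * n - 1 ∨ b.getD i 0 ≤ b.getD (i + 1) 0
  · exact Or.inl (by rw [eta, if_pos h])
  · right
    have hne := hb.half_mem_candidates hi h
    obtain ⟨x, hx, hxe⟩ := Finset.exists_mem_eq_sup _ ⟨_, hne⟩ (id : ℕ → ℕ)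
    have he : eta n b i = x := by rw [eta, if_neg h, hxe]; rfl
    rw [he]
    simp only [Finset.mem_filter, Finset.mem_range, Finset.mem_Icc] at hx
    rw [not_or, not_le] at h
    exact ⟨h.2, hx.1, hx.2.1, fun j h1 h2 => hx.2.2 j ⟨h1, h2⟩⟩

theorem eta_le (hb : IsBracketVec n b) {i : ℕ} (hi : i < 2 * n) : eta n b i ≤ b.getD i 0 := by
  rcases hb.eta_cases hi with h | h
  · exact h.le
  · exact h.2.1.le

end IsBracketVec

theorem getD_popVec (n : ℕ) (b : List ℕ) {i : ℕ} (hi : i < 2 * n) :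
    (popVec n b).getD i 0 = eta n b i := by
  simp [popVec, List.getD_eq_getElem?_getD, hi]

theorem length_popVec (n : ℕ) (b : List ℕ) : (popVec n b).length = 2 * n := by
  simp [popVec]

theorem IsBracketVec.pop {n : ℕ} {b : List ℕ} (hb : IsBracketVec n b) :
    IsBracketVec n (popVec n b) := by
  refine ⟨length_popVec n b, fun k hk => ?_, fun i hi => ?_, fun i hi j hij hj => ?_⟩
  · rw [getD_popVec _ _ (by omega)]
    have h0 := hb.2.1 k hk
    rcases hb.eta_cases (i := 2 * k + 1) (by omega) with h | h
    · rw [h, h0]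
    · omega
  · rw [getD_popVec _ _ hi]
    have h0 := hb.2.2.1 i hi
    rcases hb.eta_cases hi with h | h <;> omega
  · rw [getD_popVec _ _ hi] at hj ⊢
    have h0 := hb.2.2.1 i hi
    have hle := hb.eta_le hi
    have hj' : j < 2 * n := by omega
    rw [getD_popVec _ _ hj']
    refine (hb.eta_le hj').trans ?_
    rcases hb.eta_cases hi with h | h
    · rw [h] at hj ⊢
      exact hb.2.2.2 i hi j hij hj
    · exact h.2.2.2 j hij hj

theorem IsBracketVec.iterate_popVec {n : ℕ} {b : List ℕ} (hb : IsBracketVec n b) (t : ℕ) :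
    IsBracketVec n ((popVec n)^[t] b) := by
  induction t with
  | zero => exact hb
  | succ t ih => rw [Function.iterate_succ_apply']; exact ih.pop

/-- The sum of two bracket vectors, the first one having size `k`. -/
def joinVec (k : ℕ) (u v : List ℕ) : List ℕ := u ++ v.map (· + k)

theorem getD_joinVec_left {k : ℕ} {u : List ℕ} (v : List ℕ) (hu : u.length = 2 * k) {i : ℕ}
    (hi : i < 2 * k) : (joinVec k u v).getD i 0 = u.getD i 0 := by
  rw [joinVec, List.getD_append _ _ _ _ (by omega)]

theorem getD_joinVec_right {k m : ℕ} {u v : List ℕ} (hu : u.length = 2 * k)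
    (hv : v.length = 2 * m) {i : ℕ} (hi : i < 2 * m) :
    (joinVec k u v).getD (2 * k + i) 0 = v.getD i 0 + k := by
  rw [joinVec, List.getD_append_right _ _ _ _ (by omega), hu, Nat.add_sub_cancel_left]
  simp [List.getD_eq_getElem?_getD, show i < v.length by omega]

theorem joinVec_inj {k : ℕ} {u u' v v' : List ℕ} (hu : u.length = u'.length) :
    joinVec k u v = joinVec k u' v' ↔ u = u' ∧ v = v' := by
  constructor
  · intro h
    obtain ⟨h1, h2⟩ := List.append_inj h hu
    exact ⟨h1, List.map_injective_iff.2 (add_left_injective k) h2⟩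
  · rintro ⟨rfl, rfl⟩
    rfl

theorem joinVec_minVec (k m : ℕ) : joinVec k (minVec k) (minVec m) = minVec (k + m) := by
  rw [joinVec, minVec, minVec, minVec, mul_add, List.range_add, List.map_append, List.map_map,
    List.map_map]
  congr 1
  refine List.map_congr_left fun i _ => ?_
  simp only [Function.comp]
  omega

section Join

variable {k m : ℕ} {u v : List ℕ}

theorem IsBracketVec.join (hu : IsBracketVec k u) (hv : IsBracketVec m v) :
    IsBracketVec (k + m) (joinVec k u v) := by
  have hl : ∀ i, i < 2 * k → _ := fun i hi => getD_joinVec_left v hu.1 hi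
  have hr : ∀ i, i < 2 * m → _ := fun i hi => getD_joinVec_right hu.1 hv.1 hi
  refine ⟨by simp [joinVec, hu.1, hv.1, mul_add], fun i hi => ?_, fun i hi => ?_,
    fun i hi j hij hj => ?_⟩
  · by_cases h : i < k
    · rw [hl _ (by omega), hu.2.1 i h]
    · have := hr (2 * (i - k) + 1) (by omega)
      rw [show 2 * k + (2 * (i - k) + 1) = 2 * i + 1 by omega] at this
      rw [this, hv.2.1 _ (by omega)]
      omega
  · by_cases h : i < 2 * k
    · rw [hl _ h]
      have := hu.2.2.1 i h
      omega
    · obtain ⟨i, rfl⟩ := Nat.exists_eq_add_of_le (not_lt.1 h)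
      rw [hr _ (by omega)]
      have := hv.2.2.1 i (by omega)
      omega
  · by_cases h : i < 2 * k
    · rw [hl _ h] at hj ⊢
      have := hu.2.2.1 i h
      rw [hl _ (by omega)]
      exact hu.2.2.2 i h j hij hj
    · obtain ⟨i, rfl⟩ := Nat.exists_eq_add_of_le (not_lt.1 h)
      obtain ⟨j, rfl⟩ := Nat.exists_eq_add_of_le (show 2 * k ≤ j by omega)
      rw [hr i (by omega)] at hj ⊢
      have := hv.2.2.1 i (by omega)
      rw [hr j (by omega)]
      have := hv.2.2.2 i (by omega) j (by omega) (by omega)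
      omega

theorem eta_joinVec_left (hu : IsBracketVec k u) (hv : IsBracketVec m v) {i : ℕ}
    (hi : i < 2 * k) : eta (k + m) (joinVec k u v) i = eta k u i := by
  have hl : ∀ i, i < 2 * k → _ := fun i hi => getD_joinVec_left v hu.1 hi
  by_cases hlast : i = 2 * k - 1
  · have h : i = 2 * (k + m) - 1 ∨
        (joinVec k u v).getD i 0 ≤ (joinVec k u v).getD (i + 1) 0 := by
      rcases Nat.eq_zero_or_pos m with hm | hm
      · left; omega
      · right
        have h1 := getD_joinVec_right hu.1 hv.1 (i := 0) (by omega)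
        rw [show 2 * k + 0 = i + 1 by omega] at h1
        have := hu.2.2.1 i hi
        rw [h1, hl i hi]
        omega
    rw [eta, if_pos h, eta, if_pos (Or.inl hlast), hl i hi]
  · have hb := hu.2.2.1 i hi
    have hc : (i = 2 * (k + m) - 1 ∨ u.getD i 0 ≤ u.getD (i + 1) 0) ↔
        (i = 2 * k - 1 ∨ u.getD i 0 ≤ u.getD (i + 1) 0) := by
      rw [or_iff_right hlast, or_iff_right (by omega)]
    rw [eta, eta, hl i hi, hl (i + 1) (by omega)]
    refine if_congr hc rfl (congrArg (fun s => Finset.sup s id) (Finset.ext fun x => ?_))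
    simp only [Finset.mem_filter, Finset.mem_range]
    refine and_congr_right fun hx => and_congr_right fun _ => forall₂_congr fun j hj => ?_
    rw [Finset.mem_Icc] at hj
    rw [hl j (by omega)]

theorem eta_joinVec_right (hu : IsBracketVec k u) (hv : IsBracketVec m v) {i : ℕ}
    (hi : i < 2 * m) : eta (k + m) (joinVec k u v) (2 * k + i) = eta m v i + k := by
  have hr : ∀ i, i < 2 * m → _ := fun i hi => getD_joinVec_right hu.1 hv.1 hi
  have hc : (2 * k + i = 2 * (k + m) - 1 ∨
      (joinVec k u v).getD (2 * k + i) 0 ≤ (joinVec k u v).getD (2 * k + i + 1) 0) ↔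
        (i = 2 * m - 1 ∨ v.getD i 0 ≤ v.getD (i + 1) 0) := by
    by_cases h : i = 2 * m - 1
    · exact iff_of_true (Or.inl (by omega)) (Or.inl h)
    · rw [or_iff_right h, or_iff_right (by omega), add_assoc, hr _ hi, hr _ (by omega)]
      omega
  have hb := hv.2.2.1 i hi
  by_cases h : i = 2 * m - 1 ∨ v.getD i 0 ≤ v.getD (i + 1) 0
  · rw [eta, if_pos (hc.2 h), eta, if_pos h, hr _ hi]
  · have hne := hv.half_mem_candidates hi h
    have key : ∀ y, y < m →
        ((∀ j ∈ Finset.Icc (2 * k + i + 1) (2 * (y + k) + 1), (joinVec k u v).getD j 0 ≤ y + k) ↔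
          ∀ j ∈ Finset.Icc (i + 1) (2 * y + 1), v.getD j 0 ≤ y) := by
      intro y hy
      simp only [Finset.mem_Icc]
      constructor
      · intro H j hj
        have := H (2 * k + j) (by omega)
        rw [hr _ (by omega)] at this
        omega
      · intro H j hj
        obtain ⟨j, rfl⟩ := Nat.exists_eq_add_of_le (show 2 * k ≤ j by omega)
        have := H j (by omega)
        rw [hr _ (by omega)]
        omega
    rw [eta, if_neg (hc.not.2 h), eta, if_neg h, hr _ hi]
    apply le_antisymm
    · refine Finset.sup_le fun x hx => ?_
      simp only [Finset.mem_filter, Finset.mem_range] at hx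
      obtain ⟨y, rfl⟩ := Nat.exists_eq_add_of_le' (show k ≤ x by omega)
      refine Nat.add_le_add_right (Finset.le_sup (f := id) (b := y) ?_) k
      simp only [Finset.mem_filter, Finset.mem_range]
      exact ⟨by omega, by omega, (key y (by omega)).1 hx.2.2⟩
    · obtain ⟨y, hy, hye⟩ := Finset.exists_mem_eq_sup _ ⟨_, hne⟩ (id : ℕ → ℕ)
      rw [hye]
      simp only [Finset.mem_filter, Finset.mem_range] at hy
      refine Finset.le_sup (f := id) (b := y + k) ?_
      simp only [Finset.mem_filter, Finset.mem_range]
      exact ⟨by omega, by omega, (key y (by omega)).2 hy.2.2⟩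

theorem popVec_joinVec (hu : IsBracketVec k u) (hv : IsBracketVec m v) :
    popVec (k + m) (joinVec k u v) = joinVec k (popVec k u) (popVec m v) := by
  rw [joinVec.eq_def k (popVec k u), popVec, popVec, popVec, mul_add, List.range_add,
    List.map_append, List.map_map, List.map_map]
  congr 1
  · exact List.map_congr_left fun i hi => eta_joinVec_left hu hv (List.mem_range.1 hi)
  · exact List.map_congr_left fun i hi => eta_joinVec_right hu hv (List.mem_range.1 hi)

theorem iterate_popVec_joinVec (hu : IsBracketVec k u) (hv : IsBracketVec m v) (t : ℕ) :
    (popVec (k + m))^[t] (joinVec k u v) = joinVec k ((popVec k)^[t] u) ((popVec m)^[t] v) := by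
  induction t with
  | zero => rfl
  | succ t ih =>
    simp only [Function.iterate_succ_apply', ih]
    exact popVec_joinVec (hu.iterate_popVec t) (hv.iterate_popVec t)

theorem popSortable_joinVec (hu : IsBracketVec k u) (hv : IsBracketVec m v) (t : ℕ) :
    PopSortable (k + m) t (joinVec k u v) ↔ PopSortable k t u ∧ PopSortable m t v := by
  rw [PopSortable, iterate_popVec_joinVec hu hv, ← joinVec_minVec, joinVec_inj]
  · rfl
  · rw [(hu.iterate_popVec t).1, minVec, List.length_map, List.length_range]

end Join

theorem isIrredVec_iff {k : ℕ} (hk : 0 < k) {u : List ℕ} :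
    IsIrredVec k u ↔ IsBracketVec k u ∧ u.getD 0 0 + 1 = k := by
  refine and_congr_right fun hu => ?_
  have := hu.odd_entry (i := 2 * k - 1) (by omega) (by omega)
  omega

/-- A bracket vector splits after its first irreducible component. -/
theorem IsBracketVec.exists_eq_joinVec {k m : ℕ} {b : List ℕ} (hb : IsBracketVec (k + m) b)
    (hk : b.getD 0 0 + 1 = k) :
    ∃ u v, IsIrredVec k u ∧ IsBracketVec m v ∧ b = joinVec k u v := by
  have hl : ∀ i, i < 2 * k → (b.take (2 * k)).getD i 0 = b.getD i 0 := fun i hi => by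
    simp [List.getD_eq_getElem?_getD, hi]
  have hr : ∀ i, i < 2 * m →
      ((b.drop (2 * k)).map (· - k)).getD i 0 = b.getD (2 * k + i) 0 - k := fun i hi => by
    have : 2 * k + i < b.length := by rw [hb.1]; omega
    simp [List.getD_eq_getElem?_getD, this]
  have hlen := hb.1
  refine ⟨b.take (2 * k), (b.drop (2 * k)).map (· - k), ?_, ?_, ?_⟩
  · rw [isIrredVec_iff (by omega), hl 0 (by omega)]
    have hle : ∀ i, i < 2 * k → b.getD i 0 ≤ k - 1 := fun i hi => by
      rcases Nat.eq_zero_or_pos i with rfl | h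
      · omega
      · have := hb.2.2.2 0 (by omega) i (by omega) (by omega)
        omega
    refine ⟨⟨by rw [List.length_take]; omega, fun i hi => ?_, fun i hi => ?_,
      fun i hi j hij hj => ?_⟩, hk⟩
    · rw [hl _ (by omega), hb.2.1 i (by omega)]
    · rw [hl _ hi]
      exact ⟨(hb.2.2.1 i (by omega)).1, hle i hi⟩
    · rw [hl _ hi] at hj ⊢
      have := hle i hi
      rw [hl _ (by omega)]
      exact hb.2.2.2 i (by omega) j hij hj
  · refine ⟨by rw [List.length_map, List.length_drop]; omega, fun i hi => ?_, fun i hi => ?_,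
      fun i hi j hij hj => ?_⟩
    · rw [hr _ (by omega), show 2 * k + (2 * i + 1) = 2 * (k + i) + 1 by omega,
        hb.2.1 (k + i) (by omega)]
      omega
    · rw [hr _ hi]
      have := hb.2.2.1 (2 * k + i) (by omega)
      omega
    · rw [hr _ hi] at hj ⊢
      have := hb.2.2.1 (2 * k + i) (by omega)
      rw [hr _ (by omega)]
      exact Nat.sub_le_sub_right
        (hb.2.2.2 (2 * k + i) (by omega) (2 * k + j) (by omega) (by omega)) k
  · rw [joinVec, List.map_map]
    conv_lhs => rw [← List.take_append_drop (2 * k) b]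
    congr 1
    refine List.ext_getElem (by simp) fun i h1 h2 => ?_
    rw [List.length_drop] at h1
    have := (hb.2.2.1 (2 * k + i) (by omega)).1
    rw [List.getD_eq_getElem _ _ (by omega)] at this
    simp only [List.getElem_drop, List.getElem_map, Function.comp]
    omega

theorem finite_isBracketVec (n : ℕ) : {b | IsBracketVec n b}.Finite := by
  refine ((List.finite_length_eq (Fin n) (2 * n)).image (List.map Fin.val)).subset fun b hb => ?_
  have hlt : ∀ x ∈ b, x < n := fun x hx => by
    obtain ⟨i, hi, rfl⟩ := List.getElem_of_mem hx
    have hi' := hi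
    rw [hb.1] at hi'
    have := (hb.2.2.1 i hi').2
    rw [List.getD_eq_getElem _ _ hi] at this
    omega
  refine ⟨b.pmap Fin.mk hlt, by simp [hb.1], by simp [List.map_pmap]⟩

theorem ncard_sortable_eq_sum (t n : ℕ) (hn : 0 < n) :
    Set.ncard {b | IsBracketVec n b ∧ PopSortable n t b} =
      ∑ p ∈ Finset.HasAntidiagonal.antidiagonal n, (if p.1 = 0 then 0 else
        Set.ncard {b | IsIrredVec p.1 b ∧ PopSortable p.1 t b}) *
          Set.ncard {b | IsBracketVec p.2 b ∧ PopSortable p.2 t b} := by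
  have hfin : {b | IsBracketVec n b ∧ PopSortable n t b}.Finite :=
    (finite_isBracketVec n).subset fun b hb => hb.1
  rw [Set.ncard_eq_toFinset_card _ hfin, Finset.card_eq_sum_card_fiberwise
    (f := fun b : List ℕ => (b.getD 0 0 + 1, n - (b.getD 0 0 + 1)))
    (t := Finset.HasAntidiagonal.antidiagonal n)]
  · refine Finset.sum_congr rfl fun p hp => ?_
    obtain ⟨k, m⟩ := p
    obtain rfl : k + m = n := Finset.HasAntidiagonal.mem_antidiagonal.1 hp
    dsimp only
    split_ifs with hk
    · subst hk
      simp
    · rw [← Set.ncard_coe_finset, ← Set.ncard_prod, ← Set.InjOn.ncard_image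
        (f := fun p : List ℕ × List ℕ => joinVec k p.1 p.2)]
      · congr 1
        ext b
        simp only [Finset.coe_filter, Set.Finite.mem_toFinset, Set.mem_ofPred_eq, Set.mem_image,
          Set.mem_prod, Prod.exists, Prod.mk.injEq]
        constructor
        · rintro ⟨⟨hb, hs⟩, hbk, -⟩
          obtain ⟨u, v, hu, hv, rfl⟩ := hb.exists_eq_joinVec hbk
          rw [popSortable_joinVec hu.1 hv] at hs
          exact ⟨u, v, ⟨⟨hu, hs.1⟩, hv, hs.2⟩, rfl⟩
        · rintro ⟨u, v, ⟨⟨hu, hus⟩, hv, hvs⟩, rfl⟩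
          have h0 := ((isIrredVec_iff (by omega)).1 hu).2
          rw [getD_joinVec_left v hu.1.1 (by omega)]
          exact ⟨⟨hu.1.join hv, (popSortable_joinVec hu.1 hv t).2 ⟨hus, hvs⟩⟩, h0, by omega⟩
      · rintro ⟨u, v⟩ ⟨hu, -⟩ ⟨u', v'⟩ ⟨hu', -⟩ h
        obtain ⟨h1, h2⟩ := (joinVec_inj (hu.1.1.1.trans hu'.1.1.1.symm)).1 h
        exact Prod.ext h1 h2
  · intro b hb
    have hb' := (hfin.mem_toFinset.1 hb).1.2.2.1 0 (by omega)
    simp only [Finset.mem_coe,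
      Finset.HasAntidiagonal.mem_antidiagonal]
    omega

theorem ncard_sortable_zero (t : ℕ) :
    Set.ncard {b | IsBracketVec 0 b ∧ PopSortable 0 t b} = 1 := by
  rw [Set.ncard_eq_one]
  refine ⟨[], Set.eq_singleton_iff_unique_mem.2 ⟨?_, fun b hb => ?_⟩⟩
  · have h : IsBracketVec 0 [] := by simp [IsBracketVec]
    refine ⟨h, ?_⟩
    rw [PopSortable, List.eq_nil_of_length_eq_zero (h.iterate_popVec t).1]
    rfl
  · exact List.eq_nil_of_length_eq_zero hb.1.1

open PowerSeries in
/-- **Theorem (Statement 5).** Fix `t ≥ 1`.  With `h_t(n)` the number of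
`t`-Pop-sortable bracket vectors of size `n` and `g_t(n)` the number of
`t`-Pop-sortable irreducible bracket vectors of size `n`, we have
`(1 + ∑_{n≥1} h_t(n) zⁿ)·(1 - ∑_{n≥1} g_t(n) zⁿ) = 1` as formal power series. -/
theorem sortable_gf_decomposition (t : ℕ) (ht : 1 ≤ t) :
    (1 + PowerSeries.mk fun n =>
        if n = 0 then 0
        else (Set.ncard {b : List ℕ | IsBracketVec n b ∧ PopSortable n t b} : ℤ)) *
      (1 - PowerSeries.mk fun n =>
        if n = 0 then 0
        else (Set.ncard {b : List ℕ | IsIrredVec n b ∧ PopSortable n t b} : ℤ)) = 1 := by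
  set H : PowerSeries ℤ := PowerSeries.mk fun n =>
    (Set.ncard {b : List ℕ | IsBracketVec n b ∧ PopSortable n t b} : ℤ) with hH
  set G : PowerSeries ℤ := PowerSeries.mk fun n => if n = 0 then 0
    else (Set.ncard {b : List ℕ | IsIrredVec n b ∧ PopSortable n t b} : ℤ) with hG
  have h1 : (1 + PowerSeries.mk fun n => if n = 0 then 0
      else (Set.ncard {b : List ℕ | IsBracketVec n b ∧ PopSortable n t b} : ℤ)) = H := by
    ext n
    rcases Nat.eq_zero_or_pos n with rfl | hn
    · simp [hH, ncard_sortable_zero, -PowerSeries.coeff_zero_eq_constantCoeff]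
    · simp [hH, hn.ne', PowerSeries.coeff_one]
  have h2 : H = 1 + G * H := by
    ext n
    rcases Nat.eq_zero_or_pos n with rfl | hn
    · simp [hH, hG, ncard_sortable_zero, PowerSeries.coeff_mul,
        -PowerSeries.coeff_zero_eq_constantCoeff]
    · simp only [hH, hG, map_add, PowerSeries.coeff_mul, PowerSeries.coeff_mk,
        PowerSeries.coeff_one, hn.ne', if_false, zero_add]
      rw [ncard_sortable_eq_sum t n hn]
      push_cast
      rfl
  rw [h1]
  linear_combination h2
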